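/- Let S be a positive semifield, f : X → C Y a function, and {g_i}_{i∈I} a nonempty family of functions Y → C Z that is directed with respect to the pointwise inclusion order. Define (⨆_i g_i)(y) = conv(⋃_i g_i(y)). Then for every x ∈ X, ((⨆_i g_i) ⊙ f)(x) = conv(⋃_i (g_i ⊙ f)(x)). -/

import Mathlib

universe u

/-- The structure map of the free `S`-module (semimodule) monad on a left `S`-module `M`:
`a(φ) = Σ_{x ∈ supp φ} φ(x) • x`. -/
noncomputable def structMap (S : Type*) (M : Type*) [Semiring S] [AddCommMonoid M]
    [Module S M] (φ : M →₀ S) : M :=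
  φ.sum fun x s => s • x

/-- The convex closure of a subset `A` of a left `S`-module:
`conv(A) = { a(φ) | φ finitely supported, supp φ ⊆ A, Σ_x φ(x) = 1 }`. -/
def convClos (S : Type*) {M : Type*} [Semiring S] [AddCommMonoid M] [Module S M]
    (A : Set M) : Set M :=
  { m | ∃ φ : M →₀ S, ↑φ.support ⊆ A ∧ (φ.sum fun _ s => s) = 1 ∧ structMap S M φ = m }

/-- A subset of a left `S`-module is convex if it equals its convex closure. -/
def IsConvex (S : Type*) {M : Type*} [Semiring S] [AddCommMonoid M] [Module S M]
    (A : Set M) : Prop :=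
  convClos S A = A

/-- `c(Φ)`: the set of finitely supported functions of the form
`x ↦ Σ_{A ∈ supp Φ, u(A) = x} Φ(A)` for choice functions `u` with `u(A) ∈ A` on `supp Φ`. -/
noncomputable def choiceSet {S : Type*} {X : Type*} [Semiring S] (Φ : Set X →₀ S) :
    Set (X →₀ S) :=
  { φ | ∃ u : Set X → X, (∀ A ∈ Φ.support, u A ∈ A) ∧ φ = Finsupp.mapDomain u Φ }

/-- The canonical weak distributive law `δ_X(Φ) = conv(c(Φ))`,
the convex closure being taken in the module `X →₀ S`. -/
noncomputable def deltaLaw (S : Type*) {X : Type*} [Semiring S] (Φ : Set X →₀ S) :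
    Set (X →₀ S) :=
  convClos S (choiceSet Φ)

/-- `α_a(Φ) = { a(φ) | φ ∈ c(Φ) }`, where `a` is the structure map of the module `M`. -/
noncomputable def alphaMap (S : Type*) {M : Type*} [Semiring S] [AddCommMonoid M]
    [Module S M] (Φ : Set M →₀ S) : Set M :=
  structMap S M '' choiceSet Φ

/-- The Eilenberg–Moore style description of `δ_X(Φ)` via witnesses
`ψ` finitely supported on `{(A, x) | x ∈ A}` such that
`Φ(A) = Σ_{x ∈ A} ψ(A,x)` for all `A` and `φ(x) = Σ_{A ∋ x} ψ(A,x)` for all `x`. -/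
noncomputable def deltaEM (S : Type*) {X : Type*} [Semiring S] (Φ : Set X →₀ S) :
    Set (X →₀ S) :=
  { φ | ∃ ψ : (Set X × X) →₀ S,
      (∀ p ∈ ψ.support, p.2 ∈ p.1) ∧
      Finsupp.mapDomain Prod.fst ψ = Φ ∧
      Finsupp.mapDomain Prod.snd ψ = φ }

/-- The multiplication of the convex-powerset-of-semimodule monad:
`μ(𝒜) = ⋃_{Ω ∈ 𝒜} α(Ω)`. -/
noncomputable def muC (S : Type*) {M : Type*} [Semiring S] [AddCommMonoid M] [Module S M]
    (𝒜 : Set (Set M →₀ S)) : Set M :=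
  ⋃ Ω ∈ 𝒜, alphaMap S Ω

/-- The Kleisli extension `g♯` of `g : Y → C Z`:
`g♯(𝒜) = ⋃_{φ ∈ 𝒜} { Σ_{y ∈ supp φ} φ(y) • ψ_y | ψ_y ∈ g(y) }`. -/
noncomputable def kleisliExt {S : Type*} {Y Z : Type*} [Semiring S]
    (g : Y → Set (Z →₀ S)) (𝒜 : Set (Y →₀ S)) : Set (Z →₀ S) :=
  ⋃ φ ∈ 𝒜, { χ | ∃ ψ : Y → (Z →₀ S), (∀ y ∈ φ.support, ψ y ∈ g y) ∧
      χ = ∑ y ∈ φ.support, φ y • ψ y }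

theorem subset_convClos (S : Type*) {M : Type*} [Semiring S] [AddCommMonoid M] [Module S M]
    (A : Set M) : A ⊆ convClos S A := by
  intro a ha
  classical
  refine ⟨Finsupp.single a 1, fun b hb => ?_, by simp, by simp [structMap]⟩
  have hba : b = a := by simpa using Finsupp.support_single_subset hb
  exact hba ▸ ha

theorem IsConvex.sum_smul_mem {S M ι : Type*} [Semiring S] [AddCommMonoid M] [Module S M]
    {A : Set M} (hA : IsConvex S A) (s : Finset ι) (w : ι → S) (p : ι → M)
    (hp : ∀ i ∈ s, w i ≠ 0 → p i ∈ A) (hw : ∑ i ∈ s, w i = 1) :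
    ∑ i ∈ s, w i • p i ∈ A := by
  classical
  rw [← hA]
  refine ⟨∑ i ∈ s, Finsupp.single (p i) (w i), fun b hb => ?_, ?_, ?_⟩
  · obtain ⟨i, hi, hbi⟩ := Finset.mem_biUnion.1 (Finsupp.support_finsetSum hb)
    obtain ⟨rfl, hwi⟩ := (Finsupp.mem_support_single _ _ _).1 hbi
    exact hp i hi hwi
  · rw [← Finsupp.sum_finsetSum_index (by simp) (by simp), ← hw]
    simp
  · rw [structMap, ← Finsupp.sum_finsetSum_index (by simp) (by simp [add_smul])]
    simp

theorem isConvex_iUnion_of_directed {S M I : Type*} [Semiring S] [AddCommMonoid M] [Module S M]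
    [Nonempty I] {D : I → Set M} (hD : ∀ i, IsConvex S (D i)) (hdir : Directed (· ⊆ ·) D) :
    IsConvex S (⋃ i, D i) := by
  refine (subset_convClos S _).antisymm' ?_
  rintro m ⟨φ, hφ, hsum, rfl⟩
  obtain ⟨k, hk⟩ := hdir.exists_mem_subset_of_finset_subset_biUnion hφ
  refine Set.mem_iUnion.2 ⟨k, ?_⟩
  rw [← hD k]
  exact ⟨φ, hk, hsum, rfl⟩

theorem mem_kleisliExt {S Y Z : Type*} [Semiring S] {g : Y → Set (Z →₀ S)} {A : Set (Y →₀ S)}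
    {χ : Z →₀ S} :
    χ ∈ kleisliExt g A ↔ ∃ φ ∈ A, ∃ ψ : Y → (Z →₀ S), (∀ y ∈ φ.support, ψ y ∈ g y) ∧
      χ = ∑ y ∈ φ.support, φ y • ψ y := by
  simp [kleisliExt]

theorem kleisliExt_mono {S Y Z : Type*} [Semiring S] {g h : Y → Set (Z →₀ S)}
    (hgh : ∀ y, g y ⊆ h y) (A : Set (Y →₀ S)) : kleisliExt g A ⊆ kleisliExt h A := by
  intro χ hχ
  obtain ⟨φ, hφ, ψ, hψ, rfl⟩ := mem_kleisliExt.1 hχ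
  exact mem_kleisliExt.2 ⟨φ, hφ, ψ, fun y hy => hgh y (hψ y hy), rfl⟩

theorem kleisliExt_iUnion_of_directed {S Y Z I : Type*} [Semiring S] [Nonempty I]
    {g : I → Y → Set (Z →₀ S)} (hdir : Directed (· ≤ ·) g) (A : Set (Y →₀ S)) :
    kleisliExt (fun y => ⋃ i, g i y) A = ⋃ i, kleisliExt (g i) A := by
  classical
  refine Set.Subset.antisymm (fun χ hχ => ?_)
    (Set.iUnion_subset fun i => kleisliExt_mono (fun y => Set.subset_iUnion (g · y) i) A)
  obtain ⟨φ, hφ, ψ, hψ, rfl⟩ := mem_kleisliExt.1 hχ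
  have hidx : ∀ y, ∃ i, y ∈ φ.support → ψ y ∈ g i y := fun y => by
    by_cases hy : y ∈ φ.support
    · obtain ⟨i, hi⟩ := Set.mem_iUnion.1 (hψ y hy)
      exact ⟨i, fun _ => hi⟩
    · exact ⟨Classical.arbitrary I, fun h => absurd h hy⟩
  choose idx hidx using hidx
  obtain ⟨k, hk⟩ := hdir.finset_le (φ.support.image idx)
  exact Set.mem_iUnion.2 ⟨k, mem_kleisliExt.2 ⟨φ, hφ, ψ, fun y hy =>
    hk (idx y) (Finset.mem_image_of_mem idx hy) y (hidx y hy), rfl⟩⟩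

theorem eq_zero_of_sum_eq_zero_of_positive {S ι : Type*} [AddCommMonoid S]
    (hpos : ∀ a b : S, a + b = 0 → a = 0 ∧ b = 0) {s : Finset ι} {w : ι → S}
    (hw : ∑ i ∈ s, w i = 0) {i : ι} (hi : i ∈ s) : w i = 0 := by
  classical
  rw [← Finset.add_sum_erase s w hi] at hw
  exact (hpos _ _ hw).1

theorem isConvex_kleisliExt {S Y Z : Type*} [DivisionSemiring S]
    (hpos : ∀ a b : S, a + b = 0 → a = 0 ∧ b = 0) {g : Y → Set (Z →₀ S)}
    (hg : ∀ y, IsConvex S (g y)) {A : Set (Y →₀ S)} (hA : IsConvex S A) :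
    IsConvex S (kleisliExt g A) := by
  classical
  refine (subset_convClos S _).antisymm' ?_
  rintro m ⟨Λ, hΛ, hsum, rfl⟩
  have hdec : ∀ χ, ∃ (φ : Y →₀ S) (ψ : Y → (Z →₀ S)), χ ∈ Λ.support →
      φ ∈ A ∧ (∀ y ∈ φ.support, ψ y ∈ g y) ∧ χ = ∑ y ∈ φ.support, φ y • ψ y := fun χ => by
    by_cases hχ : χ ∈ Λ.support
    · obtain ⟨φ, hφ, ψ, h⟩ := mem_kleisliExt.1 (hΛ hχ)
      exact ⟨φ, ψ, fun _ => ⟨hφ, h⟩⟩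
    · exact ⟨0, 0, fun h => absurd h hχ⟩
  choose φ ψ hdec using hdec
  set Φ : Y →₀ S := ∑ χ ∈ Λ.support, Λ χ • φ χ with hΦ
  have hΦ_apply (y : Y) : Φ y = ∑ χ ∈ Λ.support, Λ χ * φ χ y := by
    simp [hΦ, Finsupp.finsetSum_apply]
  refine mem_kleisliExt.2 ⟨Φ, hA.sum_smul_mem _ _ _ (fun χ hχ _ => (hdec χ hχ).1) hsum,
    fun y => ∑ χ ∈ Λ.support, ((Φ y)⁻¹ * (Λ χ * φ χ y)) • ψ χ y, fun y hy => ?_, ?_⟩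
  · refine (hg y).sum_smul_mem _ _ _ (fun χ hχ hne => (hdec χ hχ).2.1 y ?_) ?_
    · exact Finsupp.mem_support_iff.2 fun h => hne (by simp [h])
    · rw [← Finset.mul_sum, ← hΦ_apply, inv_mul_cancel₀ (Finsupp.mem_support_iff.1 hy)]
  · have hsub : ∀ χ ∈ Λ.support, (φ χ).support ⊆ Φ.support := fun χ hχ y hy => by
      refine Finsupp.mem_support_iff.2 fun h0 => ?_
      rw [hΦ_apply] at h0
      exact mul_ne_zero (Finsupp.mem_support_iff.1 hχ) (Finsupp.mem_support_iff.1 hy)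
        (eq_zero_of_sum_eq_zero_of_positive hpos h0 hχ)
    calc structMap S _ Λ
        = ∑ χ ∈ Λ.support, ∑ y ∈ Φ.support, (Λ χ * φ χ y) • ψ χ y := by
          refine Finset.sum_congr rfl fun χ hχ => ?_
          calc Λ χ • χ = Λ χ • ∑ y ∈ (φ χ).support, φ χ y • ψ χ y :=
                congrArg (Λ χ • ·) (hdec χ hχ).2.2
            _ = ∑ y ∈ (φ χ).support, (Λ χ * φ χ y) • ψ χ y := by
                simp only [Finset.smul_sum, smul_smul]
            _ = ∑ y ∈ Φ.support, (Λ χ * φ χ y) • ψ χ y :=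
                Finset.sum_subset (hsub χ hχ) fun y _ hy => by
                  simp [Finsupp.notMem_support_iff.1 hy]
      _ = ∑ y ∈ Φ.support, Φ y • ∑ χ ∈ Λ.support, ((Φ y)⁻¹ * (Λ χ * φ χ y)) • ψ χ y := by
          rw [Finset.sum_comm]
          refine Finset.sum_congr rfl fun y hy => ?_
          rw [Finset.smul_sum]
          refine Finset.sum_congr rfl fun χ _ => ?_
          rw [smul_smul, mul_inv_cancel_left₀ (Finsupp.mem_support_iff.1 hy)]

/-- for a Kleisli composition with a nonempty directed family
`{g_i : Y → C Z}`, `((⨆_i g_i) ⊙ f)(x) = conv(⋃_i (g_i ⊙ f)(x))`, where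
`(⨆_i g_i)(y) = conv(⋃_i g_i(y))` and `(g ⊙ f)(x) = g♯(f(x))`. -/
theorem kleisli_comp_directed_sup {S : Type*} [DivisionSemiring S]
    (hpos : ∀ a b : S, a + b = 0 → a = 0 ∧ b = 0)
    {X Y Z : Type u} {I : Type u} [Nonempty I]
    (f : X → Set (Y →₀ S)) (hf : ∀ x, IsConvex S (f x))
    (g : I → Y → Set (Z →₀ S)) (hg : ∀ i y, IsConvex S (g i y))
    (hdir : ∀ i j : I, ∃ k : I, (∀ y, g i y ⊆ g k y) ∧ (∀ y, g j y ⊆ g k y))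
    (x : X) :
    kleisliExt (fun y => convClos S (⋃ i, g i y)) (f x)
      = convClos S (⋃ i, kleisliExt (g i) (f x)) := by
  have hdir_le : Directed (· ≤ ·) g := hdir
  have hdir_at (y : Y) : Directed (· ⊆ ·) fun i => g i y := fun i j =>
    (hdir i j).imp fun _ hk => ⟨hk.1 y, hk.2 y⟩
  have hunion (y : Y) : convClos S (⋃ i, g i y) = ⋃ i, g i y :=
    isConvex_iUnion_of_directed (fun i => hg i y) (hdir_at y)
  simp only [hunion]
  rw [kleisliExt_iUnion_of_directed hdir_le]
  exact (isConvex_iUnion_of_directed (fun i => isConvex_kleisliExt hpos (hg i) (hf x))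
    fun i j => (hdir i j).imp fun _ hk =>
      ⟨kleisliExt_mono hk.1 (f x), kleisliExt_mono hk.2 (f x)⟩).symm
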